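/- arXiv:1403.4381 — 2 statements merged into one kernel-verified Lean document; each statement's English description precedes it below -/
import Mathlib

section
/- Let k be a commutative ring, J a filtered category, and F, G : J ⥤ ChainComplex (ModuleCat k) ℤ two diagrams of chain complexes of k-modules with a natural transformation α : F ⟶ G such that each component α_j is a quasi-isomorphism. Then the induced map colim F ⟶ colim G on filtered colimits is a quasi-isomorphism. -/
open CategoryTheory Limits

namespace FiltQI
open HomologicalComplex

/-- The differential as a natural transformation. -/
@[simps]
def dNat {C : Type*} [Category* C] [Abelian C] {ι : Type*} {c : ComplexShape ι}
    {J : Type*} [Category* J] (F : J ⥤ HomologicalComplex C c) (i i' : ι) :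
    F ⋙ eval C c i ⟶ F ⋙ eval C c i' where
  app j := (F.obj j).d i i'
  naturality _ _ f := (F.map f).comm i i'

/-- Short complex of functors. -/
noncomputable def scFun {C : Type*} [Category* C] [Abelian C] {ι : Type*} {c : ComplexShape ι}
    {J : Type*} [Category* J] (F : J ⥤ HomologicalComplex C c) (i : ι) :
    ShortComplex (J ⥤ C) where
  X₁ := F ⋙ eval C c (c.prev i)
  X₂ := F ⋙ eval C c i
  X₃ := F ⋙ eval C c (c.next i)
  f := dNat F _ _
  g := dNat F _ _
  zero := by ext j; exact (F.obj j).d_comp_d _ _ _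

/-- Functoriality of `scFun`. -/
noncomputable def scFunMap {C : Type*} [Category* C] [Abelian C] {ι : Type*} {c : ComplexShape ι}
    {J : Type*} [Category* J] {F G : J ⥤ HomologicalComplex C c} (α : F ⟶ G) (i : ι) :
    scFun F i ⟶ scFun G i where
  τ₁ := Functor.whiskerRight α (eval C c (c.prev i))
  τ₂ := Functor.whiskerRight α (eval C c i)
  τ₃ := Functor.whiskerRight α (eval C c (c.next i))
  comm₁₂ := by ext j; exact (α.app j).comm _ _
  comm₂₃ := by ext j; exact (α.app j).comm _ _

lemma inv_d {C : Type*} [Category* C] [Abelian C] {ι : Type*} {c : ComplexShape ι}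
    {J : Type*} [Category* J] [HasColimitsOfShape J C] (F : J ⥤ HomologicalComplex C c)
    (i i' : ι) :
    (preservesColimitIso (eval C c i) F).inv ≫ (colimit F).d i i' =
      colimMap (dNat F i i') ≫ (preservesColimitIso (eval C c i') F).inv := by
  refine colimit.hom_ext fun j => ?_
  refine (ι_preservesColimitIso_inv_assoc (eval C c i) F j _).trans ?_
  refine Eq.trans ?_ (ι_colimMap_assoc (dNat F i i') j _).symm
  refine Eq.trans ?_ (congrArg (fun f => (F.obj j).d i i' ≫ f)
    (ι_preservesColimitIso_inv (eval C c i') F j)).symm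
  exact (colimit.ι F j).comm i i'

lemma inv_map {C : Type*} [Category* C] [Abelian C] {ι : Type*} {c : ComplexShape ι}
    {J : Type*} [Category* J] [HasColimitsOfShape J C] {F G : J ⥤ HomologicalComplex C c}
    (α : F ⟶ G) (i : ι) :
    (preservesColimitIso (eval C c i) F).inv ≫ (colimMap α).f i =
      colimMap (Functor.whiskerRight α (eval C c i)) ≫
        (preservesColimitIso (eval C c i) G).inv := by
  refine colimit.hom_ext fun j => ?_
  refine (ι_preservesColimitIso_inv_assoc (eval C c i) F j _).trans ?_
  refine Eq.trans ?_ (ι_colimMap_assoc (Functor.whiskerRight α (eval C c i)) j _).symm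
  refine Eq.trans ?_ (congrArg (fun f => (α.app j).f i ≫ f)
    (ι_preservesColimitIso_inv (eval C c i) G j)).symm
  exact congrArg (fun f => f.f i) (ι_colimMap α j)

/-- The colimit of the short complex of functors. -/
noncomputable def scIso {C : Type*} [Category* C] [Abelian C] {ι : Type*} {c : ComplexShape ι}
    {J : Type*} [Category* J] [HasColimitsOfShape J C]
    (F : J ⥤ HomologicalComplex C c) (i : ι) :
    (scFun F i).map colim ≅ (colimit F).sc i :=
  ShortComplex.isoMk (preservesColimitIso (eval C c (c.prev i)) F).symm
    (preservesColimitIso (eval C c i) F).symm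
    (preservesColimitIso (eval C c (c.next i)) F).symm
    (inv_d F _ _) (inv_d F _ _)

theorem gen {C : Type*} [Category* C] [Abelian C] {ι : Type*} {c : ComplexShape ι}
    {J : Type*} [Category* J] [HasColimitsOfShape J C] [HasExactColimitsOfShape J C]
    {F G : J ⥤ HomologicalComplex C c} (α : F ⟶ G)
    (hα : ∀ j : J, QuasiIso (α.app j)) : QuasiIso (colimMap α) := by
  rw [quasiIso_iff]
  intro i
  rw [quasiIsoAt_iff]
  have h1 : ShortComplex.QuasiIso (scFunMap α i) := by
    rw [ShortComplex.quasiIso_iff_evaluation]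
    intro j
    exact (quasiIsoAt_iff (α.app j) i).1 ((hα j).quasiIsoAt i)
  have : PreservesFiniteLimits (colim (J := J) (C := C)) :=
    HasExactColimitsOfShape.preservesFiniteLimits
  have h2 : ShortComplex.QuasiIso ((colim (J := J) (C := C)).mapShortComplex.map (scFunMap α i)) :=
    inferInstance
  refine (ShortComplex.quasiIso_iff_of_arrow_mk_iso _ _
    (Arrow.isoMk (scIso F i) (scIso G i) ?_)).1 h2
  apply ShortComplex.hom_ext
  · exact inv_map α _
  · exact inv_map α _
  · exact inv_map α _

end FiltQI

/-- Filtered colimits of chain complexes of modules preserve quasi-isomorphisms: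
if `α : F ⟶ G` is a natural transformation between filtered diagrams of chain complexes
of `k`-modules all of whose components are quasi-isomorphisms, then the induced map on
colimits is a quasi-isomorphism. -/
theorem quasiIso_colimMap_of_filtered (k : Type) [CommRing k]
    (J : Type) [SmallCategory J] [IsFiltered J]
    (F G : J ⥤ ChainComplex (ModuleCat k) ℤ) (α : F ⟶ G)
    (hα : ∀ j : J, QuasiIso (α.app j)) :
    QuasiIso (colimMap α : colimit F ⟶ colimit G) :=
  FiltQI.gen α hα
end

section
/- Let C be a category with pushouts and let W be a class of morphisms of C that is closed under retracts. Let g : A ⟶ B and f : A' ⟶ B' be morphisms such that f is a retract of g in the arrow category of C. Suppose that for every morphism u : A ⟶ X and every morphism w : X ⟶ Y belonging to W, the induced morphism of pushouts X ⊔_A B ⟶ Y ⊔_A B (over w and the identity of B) belongs to W. Then the analogous property holds for f: for every u' : A' ⟶ X and every w : X ⟶ Y in W, the induced morphism X ⊔_{A'} B' ⟶ Y ⊔_{A'} B' belongs to W. -/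
open CategoryTheory Limits

/-- `f` is a retract of `g` in the arrow category of `C`: there are morphisms of arrows
`i : f ⟶ g` and `r : g ⟶ f` with `i ≫ r = 𝟙 f`. -/
def IsRetractOfArrow {C : Type*} [Category C] {A B A' B' : C}
    (f : A' ⟶ B') (g : A ⟶ B) : Prop :=
  ∃ (i : Arrow.mk f ⟶ Arrow.mk g) (r : Arrow.mk g ⟶ Arrow.mk f), i ≫ r = 𝟙 (Arrow.mk f)

lemma isRetractOfArrow_of_squares {C : Type*} [Category C] {A B A' B' : C}
    {f : A' ⟶ B'} {g : A ⟶ B} (il : A' ⟶ A) (ir : B' ⟶ B) (rl : A ⟶ A') (rr : B ⟶ B')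
    (hi : il ≫ g = f ≫ ir) (hr : rl ≫ f = g ≫ rr)
    (hl : il ≫ rl = 𝟙 A') (hrr : ir ≫ rr = 𝟙 B') : IsRetractOfArrow f g :=
  ⟨Arrow.homMk il ir hi, Arrow.homMk rl rr hr, Arrow.hom_ext _ _ hl hrr⟩

/-- Let `C` be a category with pushouts and `W` a class of morphisms closed under retracts.
If `f` is a retract of `g` in the arrow category and pushout along `g` preserves `W`
(meaning: for every `u : A ⟶ X` and every `w : X ⟶ Y` in `W`, the induced morphism
`X ⊔_A B ⟶ Y ⊔_A B` over `w` and `𝟙 B` belongs to `W`), then pushout along `f`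
preserves `W` in the same sense. -/
theorem pushout_pres_of_retract {C : Type*} [Category C] [HasPushouts C]
    (W : MorphismProperty C)
    (hW : ∀ ⦃X Y X' Y' : C⦄ (φ : X' ⟶ Y') (ψ : X ⟶ Y),
      IsRetractOfArrow φ ψ → W ψ → W φ)
    {A B A' B' : C} (g : A ⟶ B) (f : A' ⟶ B') (hfg : IsRetractOfArrow f g)
    (hg : ∀ (X Y : C) (u : A ⟶ X) (w : X ⟶ Y), W w →
      W (pushout.map u g (u ≫ w) g w (𝟙 B) (𝟙 A) (by simp) (by simp)))
    (X Y : C) (u' : A' ⟶ X) (w : X ⟶ Y) (hw : W w) :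
    W (pushout.map u' f (u' ≫ w) f w (𝟙 B') (𝟙 A') (by simp) (by simp)) := by
  obtain ⟨i, r, hir⟩ := hfg
  obtain ⟨il, ir, iw, hi⟩ : ∃ (il : A' ⟶ A) (ir : B' ⟶ B) (_ : il ≫ g = f ≫ ir),
      i.left = il ∧ i.right = ir := ⟨i.left, i.right, i.w, rfl, rfl⟩
  obtain ⟨rl, rr, rw', hr⟩ : ∃ (rl : A ⟶ A') (rr : B ⟶ B') (_ : rl ≫ f = g ≫ rr),
      r.left = rl ∧ r.right = rr := ⟨r.left, r.right, r.w, rfl, rfl⟩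
  have hl : il ≫ rl = 𝟙 A' := by
    rw [← hi.1, ← hr.1]; exact congrArg (fun k => k.left) hir
  have hrr : ir ≫ rr = 𝟙 B' := by
    rw [← hi.2, ← hr.2]; exact congrArg (fun k => k.right) hir
  have hl' : ∀ {Z : C} (k : A' ⟶ Z), il ≫ rl ≫ k = k := fun k => by
    rw [← Category.assoc, hl, Category.id_comp]
  have hrr' : ∀ {Z : C} (k : B' ⟶ Z), ir ≫ rr ≫ k = k := fun k => by
    rw [← Category.assoc, hrr, Category.id_comp]
  refine hW _ _ (isRetractOfArrow_of_squares
      (pushout.map u' f (rl ≫ u') g (𝟙 X) ir il (by simp [hl']) iw.symm)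
      (pushout.map (u' ≫ w) f ((rl ≫ u') ≫ w) g (𝟙 Y) ir il (by simp [hl']) iw.symm)
      (pushout.map (rl ≫ u') g u' f (𝟙 X) rr rl (by simp) rw'.symm)
      (pushout.map ((rl ≫ u') ≫ w) g (u' ≫ w) f (𝟙 Y) rr rl (by simp) rw'.symm) ?_ ?_ ?_ ?_)
    (hg X Y (rl ≫ u') w hw)
  all_goals apply pushout.hom_ext <;> simp [pushout.map, pushout.inl_desc, pushout.inr_desc, pushout.inl_desc_assoc, pushout.inr_desc_assoc, hrr']
end
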